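/- arXiv:1307.0453 — 2 statements merged into one kernel-verified Lean document; each statement's English description precedes it below -/
import Mathlib

section
/- A positive integer N is a (10,4)-reverse multiple if and only if N = 198·β, where β is a positive integer whose decimal digit list is palindromic, contains only the digits 0 and 1, and in which every maximal run of consecutive equal digits has length at least 2. -/
/-- `N` is a `(g,k)`-reverse multiple: `N` is positive and reversing its base-`g`
digit list yields the base-`g` expansion of `k * N`. -/
def IsReverseMultiple (g k N : ℕ) : Prop :=
  0 < N ∧ Nat.ofDigits g (Nat.digits g N).reverse = k * N

/-- Every maximal run of consecutive equal entries of `l` has length at least 2: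
`l` decomposes into blocks of repeated values, adjacent blocks having distinct
values (so each block is a maximal run), with every block of length at least 2. -/
def RunsAtLeastTwo (l : List ℕ) : Prop :=
  ∃ blocks : List (ℕ × ℕ),
    l = (blocks.map fun p => List.replicate p.2 p.1).flatten ∧
    (∀ p ∈ blocks, 2 ≤ p.2) ∧
    blocks.Chain' fun p q => p.1 ≠ q.1

/-! ### Digits of sums of powers of ten -/

theorem ofDigits_map_range (f : ℕ → ℕ) (n : ℕ) :
    Nat.ofDigits 10 ((List.range n).map f) = ∑ i ∈ Finset.range n, f i * 10 ^ i := by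
  induction n with
  | zero => simp
  | succ n ih => simp [List.range_succ, Nat.ofDigits_append, ih, Finset.sum_range_succ, mul_comm]

theorem ofDigits_div_pow_mod (L : List ℕ) (h : ∀ d ∈ L, d < 10) (i : ℕ) :
    Nat.ofDigits 10 L / 10 ^ i % 10 = L.getD i 0 := by
  induction L generalizing i with
  | nil => simp
  | cons a L ih =>
    have ha := h a (by simp)
    cases i with
    | zero =>
      simp [Nat.ofDigits_cons]
      omega
    | succ i =>
      have hdiv : (a + 10 * Nat.ofDigits 10 L) / 10 = Nat.ofDigits 10 L := by omega
      rw [pow_succ', ← Nat.div_div_eq_div_mul, Nat.ofDigits_cons, hdiv,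
        ih (fun d hd => h d (by simp [hd])), List.getD_cons_succ]

theorem digits_sum_range (f : ℕ → ℕ) (n : ℕ) (hf : ∀ i < n, f i < 10)
    (h : f (n - 1) ≠ 0) :
    Nat.digits 10 (∑ i ∈ Finset.range n, f i * 10 ^ i) = (List.range n).map f := by
  rw [← ofDigits_map_range]
  refine Nat.digits_ofDigits 10 (by norm_num) _ ?_ ?_
  · simpa using hf
  · intro _
    rw [List.getLast_map, List.getLast_range]
    exact h

theorem reverse_map_range (f : ℕ → ℕ) (n : ℕ) :
    ((List.range n).map f).reverse = (List.range n).map fun i => f (n - 1 - i) := by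
  apply List.ext_getElem <;> simp

/-! ### Runs of equal entries -/

/-- Every entry of `l` agrees with one of its neighbours. -/
def NoIsolatedEntry (l : List ℕ) : Prop :=
  ∀ i < l.length, l[i]? = l[i + 1]? ∨ ∃ j, j + 1 = i ∧ l[j]? = l[i]?

theorem noIsolatedEntry_replicate_append {n a : ℕ} (hn : 2 ≤ n) {l : List ℕ}
    (h : NoIsolatedEntry l) : NoIsolatedEntry (List.replicate n a ++ l) := by
  intro i hi
  rcases lt_or_ge i n with hin | hin
  · rcases lt_or_ge (i + 1) n with hin' | hin'
    · left
      simp [List.getElem?_append, hin, hin']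
    · right
      refine ⟨i - 1, by omega, ?_⟩
      simp [List.getElem?_append, hin, show i - 1 < n by omega]
  · simp only [List.length_append, List.length_replicate] at hi
    rcases h (i - n) (by omega) with h | ⟨j, hj, h⟩
    · left
      rw [List.getElem?_append_right (by simpa using hin),
        List.getElem?_append_right (by simp; omega)]
      simpa [show i + 1 - n = i - n + 1 by omega] using h
    · right
      refine ⟨i - 1, by omega, ?_⟩
      rw [List.getElem?_append_right (by rw [List.length_replicate]; omega),
        List.getElem?_append_right (by rw [List.length_replicate]; omega)]
      simpa [show i - 1 - n = j by omega] using h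

theorem RunsAtLeastTwo.noIsolatedEntry {l : List ℕ} (h : RunsAtLeastTwo l) :
    NoIsolatedEntry l := by
  obtain ⟨blocks, rfl, h2, -⟩ := h
  induction blocks with
  | nil => simp [NoIsolatedEntry]
  | cons p blocks ih =>
    exact noIsolatedEntry_replicate_append (h2 p (by simp)) (ih fun q hq => h2 q (by simp [hq]))

theorem runsAtLeastTwo_nil : RunsAtLeastTwo [] :=
  ⟨[], by simp, by simp, List.isChain_nil⟩

theorem RunsAtLeastTwo.cons {a : ℕ} {l : List ℕ} (h : RunsAtLeastTwo (a :: l)) :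
    RunsAtLeastTwo (a :: a :: l) := by
  obtain ⟨blocks, hl, h2, hc⟩ := h
  cases blocks with
  | nil => simp at hl
  | cons p blocks =>
    obtain ⟨b, m⟩ := p
    have hm : 2 ≤ m := h2 (b, m) (by simp)
    obtain ⟨m, rfl⟩ : ∃ k, m = k + 1 := ⟨m - 1, by omega⟩
    simp only [List.map_cons, List.flatten_cons, List.replicate_succ, List.cons_append,
      List.cons.injEq] at hl
    obtain ⟨rfl, rfl⟩ := hl
    refine ⟨(a, m + 2) :: blocks, by simp [List.replicate_succ], ?_, ?_⟩
    · intro q hq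
      rcases List.mem_cons.1 hq with rfl | hq
      · simp
      · exact h2 q (by simp [hq])
    · rw [List.Chain', List.isChain_cons] at hc ⊢
      exact hc

theorem RunsAtLeastTwo.cons_cons {a : ℕ} {l : List ℕ} (h : RunsAtLeastTwo l) :
    RunsAtLeastTwo (a :: a :: l) := by
  obtain ⟨blocks, rfl, h2, hc⟩ := h
  by_cases hb : ∃ m bs, blocks = (a, m) :: bs
  · obtain ⟨m, bs, rfl⟩ := hb
    have hm : 2 ≤ m := h2 (a, m) (by simp)
    obtain ⟨m, rfl⟩ : ∃ k, m = k + 1 := ⟨m - 1, by omega⟩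
    have h : RunsAtLeastTwo (a :: (List.replicate m a ++
        (bs.map fun p => List.replicate p.2 p.1).flatten)) :=
      ⟨(a, m + 1) :: bs, by simp [List.replicate_succ], h2, hc⟩
    simpa [List.replicate_succ] using h.cons.cons
  · refine ⟨(a, 2) :: blocks, by simp [List.replicate_succ], ?_, ?_⟩
    · intro q hq
      rcases List.mem_cons.1 hq with rfl | hq
      · simp
      · exact h2 q hq
    · rw [List.Chain', List.isChain_cons]
      refine ⟨?_, hc⟩
      rintro ⟨b, m⟩ hbm rfl
      cases blocks with
      | nil => simp at hbm
      | cons q bs =>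
        simp only [List.head?_cons, Option.mem_def, Option.some.injEq] at hbm
        exact hb ⟨m, bs, by rw [hbm]⟩

theorem NoIsolatedEntry.runsAtLeastTwo : ∀ {l : List ℕ}, NoIsolatedEntry l → RunsAtLeastTwo l
  | [], _ => runsAtLeastTwo_nil
  | [a], h => by simpa using h 0 (by simp)
  | [a, b], h => by
    obtain rfl : a = b := by simpa using h 0 (by simp)
    exact runsAtLeastTwo_nil.cons_cons
  | a :: b :: x :: l, h => by
    obtain rfl : a = b := by simpa using h 0 (by simp)
    by_cases hx : x = a
    · subst hx
      refine (NoIsolatedEntry.runsAtLeastTwo (l := x :: x :: l) ?_).cons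
      rintro (_ | i) hi
      · simp
      · rcases h (i + 2) (by simpa using hi) with h | ⟨j, hj, h⟩
        · exact Or.inl (by simpa using h)
        · obtain rfl : j = i + 1 := by omega
          exact Or.inr ⟨i, rfl, by simpa using h⟩
    · refine (NoIsolatedEntry.runsAtLeastTwo (l := x :: l) ?_).cons_cons
      rintro (_ | i) hi
      · rcases h 2 (by simp) with h | ⟨j, hj, h⟩
        · exact Or.inl (by simpa using h)
        · obtain rfl : j = 1 := by omega
          simp at h
          exact absurd h.symm hx
      · rcases h (i + 3) (by simpa using hi) with h | ⟨j, hj, h⟩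
        · exact Or.inl (by simpa using h)
        · obtain rfl : j = i + 2 := by omega
          exact Or.inr ⟨i, rfl, by simpa using h⟩

/-! ### Carries in the multiplication by four -/

/-- The carry into position `i` when `N` is multiplied by `4` in base ten. -/
def carry (N i : ℕ) : ℕ := 4 * (N % 10 ^ i) / 10 ^ i

theorem carry_le (N i : ℕ) : carry N i ≤ 3 := by
  have hp : 0 < 10 ^ i := by positivity
  have := Nat.mod_lt N hp
  have : carry N i < 4 := (Nat.div_lt_iff_lt_mul hp).2 (by omega)
  omega

theorem carry_succ (N i : ℕ) :
    4 * (N / 10 ^ i % 10) + carry N i = 4 * N / 10 ^ i % 10 + 10 * carry N (i + 1) := by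
  have hp : 0 < 10 ^ i := by positivity
  have h1 : 4 * N / 10 ^ i = 4 * (N / 10 ^ i) + 4 * (N % 10 ^ i) / 10 ^ i := by
    conv_lhs => rw [← Nat.div_add_mod N (10 ^ i)]
    rw [mul_add, mul_left_comm, Nat.mul_add_div hp]
  have h2 : 4 * (N % 10 ^ (i + 1)) / 10 ^ (i + 1) =
      (4 * (N / 10 ^ i % 10) + 4 * (N % 10 ^ i) / 10 ^ i) / 10 := by
    rw [Nat.mod_pow_succ, pow_succ, ← Nat.div_div_eq_div_mul, mul_add, mul_left_comm,
      add_comm, Nat.mul_add_div hp]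
  rw [carry, carry, h1, h2]
  omega

/-- One step of the multiplication, performed from both ends simultaneously: `c` and `c'` are the
carries into and out of the digit `a`, while `d'` and `d` are those of the mirror digit `b`. -/
theorem carry_step {c d a b c' d' : ℕ} (hc : c = 0 ∨ c = 3) (hd : d = 0 ∨ d = 3)
    (hb : b ≤ 9) (hc' : c' ≤ 3) (hd' : d' ≤ 3) (h1 : 4 * a + c = b + 10 * c')
    (h2 : 4 * b + d' = a + 10 * d) :
    d' = c ∧ (c' = 0 ∨ c' = 3) ∧ (c = c' ∨ c = d) ∧ 3 * a + c = 8 * c' + 2 * d := by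
  rcases hc with rfl | rfl <;> rcases hd with rfl | rfl <;> interval_cases c' <;>
    interval_cases d' <;> omega

theorem carries_of_mirrored {n : ℕ} {a c : ℕ → ℕ} (ha : ∀ i < n, a i ≤ 9) (hc : ∀ i, c i ≤ 3)
    (h0 : c 0 = 0) (hn : c n = 0)
    (h : ∀ i < n, 4 * a i + c i = a (n - 1 - i) + 10 * c (i + 1)) {i : ℕ} (hi : i < n) :
    c (n - (i + 1)) = c i ∧ (c (i + 1) = 0 ∨ c (i + 1) = 3) ∧
      (c i = c (i + 1) ∨ c i = c (n - i)) ∧ 3 * a i + c i = 8 * c (i + 1) + 2 * c (n - i) := by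
  have step {i : ℕ} (hi : i < n) (h1 : c i = 0 ∨ c i = 3) (h2 : c (n - i) = 0 ∨ c (n - i) = 3) :
      c (n - (i + 1)) = c i ∧ (c (i + 1) = 0 ∨ c (i + 1) = 3) ∧
      (c i = c (i + 1) ∨ c i = c (n - i)) ∧ 3 * a i + c i = 8 * c (i + 1) + 2 * c (n - i) := by
    refine carry_step h1 h2 (ha (n - 1 - i) (by omega)) (hc _) (hc _) (h i hi) ?_
    have := h (n - 1 - i) (by omega)
    rwa [show n - 1 - (n - 1 - i) = i by omega, show n - 1 - i + 1 = n - i by omega,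
      show c (n - 1 - i) = c (n - (i + 1)) by congr 1; omega] at this
  have state : (c i = 0 ∨ c i = 3) ∧ (c (n - i) = 0 ∨ c (n - i) = 3) := by
    induction i with
    | zero => simp [h0, hn]
    | succ i ih =>
      obtain ⟨h1, h2⟩ := ih (by omega)
      obtain ⟨h3, h4, -⟩ := step (by omega) h1 h2
      exact ⟨h4, h3 ▸ h1⟩
  exact step hi state.1 state.2

/-! ### The two implications -/

theorem exists_eq_of_isReverseMultiple {N : ℕ} (h : IsReverseMultiple 10 4 N) :
    ∃ β : ℕ, 0 < β ∧ N = 198 * β ∧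
      (Nat.digits 10 β).reverse = Nat.digits 10 β ∧
      (∀ d ∈ Nat.digits 10 β, d = 0 ∨ d = 1) ∧
      RunsAtLeastTwo (Nat.digits 10 β) := by
  obtain ⟨hN, hrev⟩ := h
  set n := (Nat.digits 10 N).length with hn
  have hn0 : 0 < n := List.length_pos_of_ne_nil (Nat.digits_ne_nil_iff_ne_zero.2 hN.ne')
  set a : ℕ → ℕ := fun i => N / 10 ^ i % 10 with ha
  have hlt : ∀ d ∈ (Nat.digits 10 N).reverse, d < 10 := fun d hd =>
    Nat.digits_lt_base (by norm_num) (List.mem_reverse.1 hd)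
  have hdig : Nat.digits 10 N = (List.range n).map a := by
    refine List.ext_getElem (by simp [hn]) fun i h1 h2 => ?_
    have := Nat.getD_digits N i (b := 10) (by norm_num)
    rw [List.getD_eq_getElem _ _ h1] at this
    simpa [ha] using this
  have hmirror : ∀ i < n, 4 * N / 10 ^ i % 10 = a (n - 1 - i) := by
    intro i hi
    rw [← hrev, ofDigits_div_pow_mod _ hlt, hdig, reverse_map_range]
    simp [List.getD_eq_getElem?_getD, hi]
  have hcn : carry N n = 0 := by
    have h4 : 4 * N < 10 ^ n := by
      rw [← hrev]
      simpa [hn] using Nat.ofDigits_lt_base_pow_length (by norm_num) hlt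
    rw [carry, Nat.mod_eq_of_lt (by omega), Nat.div_eq_of_lt h4]
  have htop : a (n - 1) ≠ 0 := by
    have := Nat.getLast_digit_ne_zero 10 hN.ne'
    simpa only [hdig, List.getLast_map, List.getLast_range] using this
  have ha9 : ∀ i, a i ≤ 9 := fun i => by
    have : a i < 10 := Nat.mod_lt _ (by norm_num)
    omega
  have hsucc : ∀ i < n, 4 * a i + carry N i = a (n - 1 - i) + 10 * carry N (i + 1) :=
    fun i hi => by rw [← hmirror i hi]; exact carry_succ N i
  have hc0 : carry N 0 = 0 := by simp [carry, Nat.mod_one]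
  have key {i : ℕ} (hi : i < n) :=
    carries_of_mirrored (fun i _ => ha9 i) (carry_le N) hc0 hcn hsucc hi
  have hc1 : carry N 1 = 3 := by
    have h1 := key hn0
    have h2 := hsucc 0 hn0
    simp only [zero_add, Nat.sub_zero, hc0, hcn] at h1 h2
    omega
  obtain ⟨m, hm, hm0⟩ : ∃ m, n = m + 2 ∧ 0 < m := by
    have hn1 : n ≠ 1 := fun h => by rw [h] at hcn; omega
    have hn2 : n ≠ 2 := fun h => by
      have := (key (i := 0) hn0).1
      simp [h] at this
      omega
    exact ⟨n - 2, by omega, by omega⟩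
  clear_value n
  subst hm
  set t : ℕ → ℕ := fun i => carry N i / 3 with ht
  have hct : ∀ i ≤ m + 2, carry N i = 3 * t i := by
    rintro (_ | i) hi
    · simp [ht, hc0]
    · have := (key (i := i) (by omega)).2.1
      simp only [ht]
      omega
  have ht0 : t 0 = 0 := by simp [ht, hc0]
  have htm2 : t (m + 2) = 0 := by simp [ht, hcn]
  have hpal {i : ℕ} (hi : i < m + 2) : t (m + 1 - i) = t i := by
    have := (key hi).1
    rw [show m + 2 - (i + 1) = m + 1 - i by omega] at this
    simp only [ht, this]
  have htm1 : t (m + 1) = 0 := by simpa [ht0] using hpal (i := 0) (by omega)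
  have hdigit {i : ℕ} (hi : i < m + 2) : a i + t i = 8 * t (i + 1) + 2 * t (m + 2 - i) := by
    have := (key hi).2.2.2
    rw [hct _ (by omega), hct _ (by omega), hct _ (by omega)] at this
    omega
  have hnbr {i : ℕ} (hi : i < m + 2) : t i = t (i + 1) ∨ t i = t (m + 2 - i) := by
    simp only [ht]
    rcases (key hi).2.2.1 with h | h <;> simp [h]
  have ht1 : ∀ i, t i = 0 ∨ t i = 1 := fun i => by
    have := carry_le N i
    simp only [ht]
    omega
  have htm : t m = 1 := by simpa [ht, hc1] using hpal (i := 1) (by omega)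
  have hβ := digits_sum_range (fun i => t (i + 1)) m
    (fun i _ => by rcases ht1 (i + 1) with h | h <;> simp [h])
    (by simp [show m - 1 + 1 = m by omega, htm])
  set β := ∑ i ∈ Finset.range m, t (i + 1) * 10 ^ i with hβdef
  have hNβ : N = 198 * β := by
    have hsum : N + ∑ i ∈ Finset.range (m + 2), t i * 10 ^ i =
        8 * ∑ i ∈ Finset.range (m + 2), t (i + 1) * 10 ^ i +
          2 * ∑ i ∈ Finset.range (m + 2), t (m + 2 - i) * 10 ^ i := by
      conv_lhs => rw [← Nat.ofDigits_digits 10 N, hdig, ofDigits_map_range]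
      rw [← Finset.sum_add_distrib, Finset.mul_sum, Finset.mul_sum, ← Finset.sum_add_distrib]
      refine Finset.sum_congr rfl fun i hi => ?_
      rw [← add_mul, hdigit (Finset.mem_range.1 hi)]
      ring
    have h1 : ∑ i ∈ Finset.range (m + 2), t i * 10 ^ i = 10 * β := by
      rw [Finset.sum_range_succ, Finset.sum_range_succ', ht0, htm1, hβdef, Finset.mul_sum]
      simp only [zero_mul, add_zero]
      exact Finset.sum_congr rfl fun i _ => by ring
    have h2 : ∑ i ∈ Finset.range (m + 2), t (i + 1) * 10 ^ i = β := by
      rw [Finset.sum_range_succ, Finset.sum_range_succ, htm2, htm1]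
      simp [hβdef]
    have h3 : ∑ i ∈ Finset.range (m + 2), t (m + 2 - i) * 10 ^ i = 100 * β := by
      rw [Finset.sum_range_succ', Finset.sum_range_succ', hβdef, Finset.mul_sum]
      simp only [zero_add, Nat.sub_zero, htm2, show m + 2 - 1 = m + 1 by omega, htm1, zero_mul,
        add_zero]
      refine Finset.sum_congr rfl fun i hi => ?_
      have hi := Finset.mem_range.1 hi
      rw [← hpal (i := i + 1) (by omega),
        show m + 2 - (i + 1 + 1) = m + 1 - (i + 1) by omega]
      ring
    omega
  refine ⟨β, by omega, hNβ, ?_, ?_, NoIsolatedEntry.runsAtLeastTwo ?_⟩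
  · rw [hβ, reverse_map_range]
    refine List.map_congr_left fun i hi => ?_
    have hi := List.mem_range.1 hi
    rw [← hpal (i := i + 1) (by omega)]
    congr 1
    omega
  · rw [hβ]
    simpa using fun i _ => ht1 (i + 1)
  · rw [hβ]
    intro i hi
    simp only [List.length_map, List.length_range] at hi
    have htm' : i + 1 = m → t (i + 1) ≠ t (i + 1 + 1) := by
      rintro rfl
      omega
    have ht0' : i = 0 → t (i + 1) ≠ t i := by
      rintro rfl
      simp [ht, hc0, hc1]
    have hpi := hpal (i := i) (by omega)
    rw [show m + 1 - i = m + 2 - (i + 1) by omega] at hpi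
    rcases hnbr (i := i + 1) (by omega) with h | h
    · left
      have : i + 1 < m := by
        by_contra
        exact htm' (by omega) h
      simpa [hi, this] using h
    · right
      rw [hpi] at h
      rcases i with _ | i
      · exact absurd h (ht0' rfl)
      · exact ⟨i, rfl, by simpa [hi, show i < m by omega] using h.symm⟩

theorem isReverseMultiple_mul {β : ℕ} (hβ : 0 < β)
    (hpal : (Nat.digits 10 β).reverse = Nat.digits 10 β)
    (hbit : ∀ d ∈ Nat.digits 10 β, d = 0 ∨ d = 1)
    (hruns : RunsAtLeastTwo (Nat.digits 10 β)) : IsReverseMultiple 10 4 (198 * β) := by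
  refine ⟨by omega, ?_⟩
  have hnbr := hruns.noIsolatedEntry
  have hne : Nat.digits 10 β ≠ [] := Nat.digits_ne_nil_iff_ne_zero.2 hβ.ne'
  have hlast : (Nat.digits 10 β).getLast hne ≠ 0 := Nat.getLast_digit_ne_zero 10 hβ.ne'
  have hof := Nat.ofDigits_digits 10 β
  generalize Nat.digits 10 β = L at *
  set m := L.length with hm
  have hm0 : 0 < m := List.length_pos_of_ne_nil hne
  set f : ℕ → ℕ := fun i => L.getD i 0 with hf
  have hLf : L = (List.range m).map f := by
    refine List.ext_getElem (by simp [hm]) fun i h1 h2 => ?_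
    simp [hf, h1]
  have hfm : ∀ i, m ≤ i → f i = 0 := fun i hi => List.getD_eq_default _ _ hi
  have hf1 : ∀ i, f i = 0 ∨ f i = 1 := fun i => by
    rcases lt_or_ge i m with hi | hi
    · rw [hf]
      simp only [List.getD_eq_getElem _ _ hi]
      exact hbit _ (List.getElem_mem _)
    · exact Or.inl (hfm i hi)
  have hftop : f (m - 1) = 1 := by
    refine (hf1 _).resolve_left fun h => hlast ?_
    rw [List.getLast_eq_getElem, ← h, hf]
    simp only
    rw [List.getD_eq_getElem]
  have hfpal : ∀ i < m, f (m - 1 - i) = f i := fun i hi => by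
    have := congrArg (fun l => l.getD i 0) hpal
    simp only [hf]
    rw [← this, List.getD_eq_getElem _ _ (by omega), List.getD_eq_getElem _ _ (by simpa using hi),
      List.getElem_reverse]
  have hfnbr : ∀ i, f i = f (i + 1) ∨ ∃ j, j + 1 = i ∧ f j = f i := fun i => by
    rcases lt_or_ge i m with hi | hi
    · rcases hnbr i hi with h | ⟨j, hj, h⟩
      · exact Or.inl (by simp [hf, List.getD_eq_getElem?_getD, h])
      · exact Or.inr ⟨j, hj, by simp [hf, List.getD_eq_getElem?_getD, h]⟩
    · exact Or.inl (by rw [hfm i hi, hfm (i + 1) (by omega)])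
  set s : ℕ → ℕ := fun i => if i < 2 then 0 else f (i - 2) with hs
  have hs0 : s 0 = 0 := by simp [hs]
  have hs1 : s 1 = 0 := by simp [hs]
  have hs2 : ∀ i, s (i + 2) = f i := fun i => by simp [hs]
  have hsbit : ∀ i, s i = 0 ∨ s i = 1 := fun i => by
    simp only [hs]
    split_ifs
    · simp
    · exact hf1 _
  have hspal : ∀ i ≤ m + 3, s (m + 3 - i) = s i := fun i hi => by
    simp only [hs]
    split_ifs with h1 h2 h2
    · rfl
    · exact (hfm _ (by omega)).symm
    · exact hfm _ (by omega)
    · rw [← hfpal (i - 2) (by omega)]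
      congr 1
      omega
  have hsnbr : ∀ i, s (i + 1) = s (i + 2) ∨ s (i + 1) = s i := fun i => by
    rcases i with _ | i
    · simp [hs0, hs1]
    · rcases hfnbr i with h | ⟨j, rfl, h⟩
      · exact Or.inl (by rw [hs2 (i + 1), ← h, ← hs2])
      · exact Or.inr (by rw [hs2, hs2, h])
  set a : ℕ → ℕ := fun i => 8 * s (i + 2) + 2 * s i - s (i + 1) with ha
  have has : ∀ i, a i + s (i + 1) = 8 * s (i + 2) + 2 * s i := fun i => by
    have := hsnbr i
    have := hsbit (i + 1)
    simp only [ha]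
    omega
  have hβsum : β = ∑ i ∈ Finset.range m, f i * 10 ^ i := by
    rw [← hof, hLf, ofDigits_map_range]
  have h8 : ∑ i ∈ Finset.range (m + 2), s (i + 2) * 10 ^ i = β := by
    rw [Finset.sum_range_succ, Finset.sum_range_succ, hs2, hs2, hfm m le_rfl,
      hfm (m + 1) (by omega), hβsum]
    simp [hs2]
  have h1 : ∑ i ∈ Finset.range (m + 2), s (i + 1) * 10 ^ i = 10 * β := by
    rw [Finset.sum_range_succ, Finset.sum_range_succ', hs2, zero_add, hs1, hfm m le_rfl, hβsum,
      Finset.mul_sum]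
    simp only [zero_mul, add_zero]
    exact Finset.sum_congr rfl fun i _ => by rw [hs2]; ring
  have h2 : ∑ i ∈ Finset.range (m + 2), s i * 10 ^ i = 100 * β := by
    rw [Finset.sum_range_succ', Finset.sum_range_succ', zero_add, hs1, hs0, hβsum,
      Finset.mul_sum]
    simp only [zero_mul, add_zero]
    exact Finset.sum_congr rfl fun i _ => by rw [hs2]; ring
  have hforward : ∑ i ∈ Finset.range (m + 2), a i * 10 ^ i = 198 * β := by
    have : ∑ i ∈ Finset.range (m + 2), a i * 10 ^ i +
        ∑ i ∈ Finset.range (m + 2), s (i + 1) * 10 ^ i =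
        8 * ∑ i ∈ Finset.range (m + 2), s (i + 2) * 10 ^ i +
          2 * ∑ i ∈ Finset.range (m + 2), s i * 10 ^ i := by
      rw [← Finset.sum_add_distrib, Finset.mul_sum, Finset.mul_sum, ← Finset.sum_add_distrib]
      refine Finset.sum_congr rfl fun i _ => ?_
      rw [← add_mul, has]
      ring
    omega
  have hbackward : ∑ i ∈ Finset.range (m + 2), a (m + 2 - 1 - i) * 10 ^ i = 4 * (198 * β) := by
    have : ∑ i ∈ Finset.range (m + 2), a (m + 2 - 1 - i) * 10 ^ i +
        ∑ i ∈ Finset.range (m + 2), s (i + 1) * 10 ^ i =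
        8 * ∑ i ∈ Finset.range (m + 2), s i * 10 ^ i +
          2 * ∑ i ∈ Finset.range (m + 2), s (i + 2) * 10 ^ i := by
      rw [← Finset.sum_add_distrib, Finset.mul_sum, Finset.mul_sum, ← Finset.sum_add_distrib]
      refine Finset.sum_congr rfl fun i hi => ?_
      have hi := Finset.mem_range.1 hi
      have := has (m + 2 - 1 - i)
      rw [show m + 2 - 1 - i + 1 = m + 3 - (i + 1) by omega,
        show m + 2 - 1 - i + 2 = m + 3 - i by omega, hspal _ (by omega), hspal _ (by omega),
        show s (m + 2 - 1 - i) = s (i + 2) by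
          rw [← hspal (i + 2) (by omega)]
          congr 1
          omega] at this
      rw [← add_mul, this]
      ring
    omega
  have hdig := digits_sum_range a (m + 2)
    (fun i _ => by
      have := has i
      have := hsnbr i
      have := hsbit (i + 1)
      have := hsbit (i + 2)
      have := hsbit i
      omega)
    (by
      have h := has (m + 1)
      rw [hs2, hs2, hfm m le_rfl, hfm (m + 1) (by omega), show m + 1 = m - 1 + 2 by omega, hs2,
        hftop] at h
      rw [show m + 2 - 1 = m - 1 + 2 by omega]
      omega)
  rw [← hforward, hdig, reverse_map_range, ofDigits_map_range, hbackward, hforward]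

theorem reverse_multiple_10_4_iff (N : ℕ) (hN : 0 < N) :
    IsReverseMultiple 10 4 N ↔
      ∃ β : ℕ, 0 < β ∧ N = 198 * β ∧
        (Nat.digits 10 β).reverse = Nat.digits 10 β ∧
        (∀ d ∈ Nat.digits 10 β, d = 0 ∨ d = 1) ∧
        RunsAtLeastTwo (Nat.digits 10 β) := by
  refine ⟨exists_eq_of_isReverseMultiple, ?_⟩
  rintro ⟨β, hβ, rfl, hpal, hbit, hruns⟩
  exact isReverseMultiple_mul hβ hpal hbit hruns
end

section
/- For every integer t ≥ 4, the number of positive integers N with exactly t decimal digits such that N is a (10,k)-reverse multiple for some k with 2 ≤ k ≤ 9 equals 2·F_{⌊t/2⌋−1} (with F_1 = F_2 = 1). -/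
namespace ReverseMultiple

/-- Lists of `n` decimal digits, least significant first, whose product by `k`, with carry `c`
coming in, is the reversed list with carry `d` going out. -/
def carryLists (k c d n : ℕ) : Set (List ℕ) :=
  {L | L.length = n ∧ (∀ x ∈ L, x < 10) ∧
    k * Nat.ofDigits 10 L + c = Nat.ofDigits 10 L.reverse + d * 10 ^ n}

/-- Surround a list by a new first and a new last entry. -/
def wrap (a b : ℕ) (M : List ℕ) : List ℕ := a :: (M ++ [b])

theorem wrap_injective (a b : ℕ) : Function.Injective (wrap a b) := by
  intro M M' h
  simpa [wrap] using h

theorem exists_eq_wrap {L : List ℕ} {n : ℕ} (h : L.length = n + 2) :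
    ∃ a b M, L = wrap a b M := by
  obtain _ | ⟨a, L⟩ := L
  · simp at h
  · rcases List.eq_nil_or_concat L with rfl | ⟨M, b, rfl⟩
    · simp at h
    · exact ⟨a, b, M, by simp [wrap]⟩

theorem ofDigits_wrap (a b : ℕ) (M : List ℕ) :
    Nat.ofDigits 10 (wrap a b M) =
      a + 10 * Nat.ofDigits 10 M + 10 * 10 ^ M.length * b := by
  simp [wrap, Nat.ofDigits_cons, Nat.ofDigits_append]
  ring

theorem reverse_wrap (a b : ℕ) (M : List ℕ) : (wrap a b M).reverse = wrap b a M.reverse := by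
  simp [wrap]

/-- Peeling off the two outer digits changes the two carries. -/
theorem wrap_mem_carryLists {k c d n a b : ℕ} {M : List ℕ} (hc : c < k) :
    wrap a b M ∈ carryLists k c d (n + 2) ↔
      a < 10 ∧ b < 10 ∧ ∃ c' d', c' < k ∧ d' < k ∧ k * a + c = b + 10 * c' ∧
        a + 10 * d = k * b + d' ∧ M ∈ carryLists k c' d' n := by
  simp only [carryLists, Set.mem_ofPred_eq, reverse_wrap, ofDigits_wrap, List.length_reverse]
  constructor
  · rintro ⟨hl, hd, he⟩
    have hl : M.length = n := by simpa [wrap] using hl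
    have ha : a < 10 := hd a (by simp [wrap])
    have hb : b < 10 := hd b (by simp [wrap])
    have hM : ∀ x ∈ M, x < 10 := fun x hx => hd x (by simp [wrap, hx])
    have h1 : Nat.ofDigits 10 M < 10 ^ n := hl ▸ Nat.ofDigits_lt_base_pow_length (by norm_num) hM
    have h2 : Nat.ofDigits 10 M.reverse < 10 ^ n := by
      have := Nat.ofDigits_lt_base_pow_length (b := 10) (l := M.reverse) (by norm_num)
        (by simpa using hM)
      simpa [hl] using this
    rw [hl] at he
    generalize Nat.ofDigits 10 M = x at *
    generalize Nat.ofDigits 10 M.reverse = y at *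
    have hp : 10 ^ (n + 2) = 100 * 10 ^ n := by ring
    rw [hp] at he
    generalize 10 ^ n = P at *
    obtain ⟨c', hc'⟩ : ∃ c', k * a + c = b + 10 * c' := by
      have e : k * a + c + 10 * (k * x + k * P * b) = b + 10 * (y + P * a + 10 * P * d) := by
        linarith
      generalize k * x + k * P * b = u at e
      generalize y + P * a + 10 * P * d = v at e
      by_cases hle : b ≤ k * a + c
      · exact ⟨(k * a + c - b) / 10, by omega⟩
      · exact absurd e (by omega)
    have hck : c' < k := by nlinarith
    have e : k * x + c' + P * (k * b) = y + P * (a + 10 * d) := by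
      linarith
    obtain ⟨d', hd'⟩ : ∃ d', a + 10 * d = k * b + d' := by
      apply Nat.exists_eq_add_of_le
      by_contra! hlt
      nlinarith
    rw [hd'] at e
    refine ⟨ha, hb, c', d', hck, ?_, hc', hd', hl, hM, by linarith⟩
    by_contra! hlt
    nlinarith
  · rintro ⟨ha, hb, c', d', -, -, h1, h2, hl, hM, he⟩
    refine ⟨by simp [wrap, hl], ?_, ?_⟩
    · intro x hx
      simp only [wrap, List.mem_cons, List.mem_append, List.not_mem_nil, or_false] at hx
      rcases hx with rfl | hx | rfl
      exacts [ha, hM x hx, hb]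
    · rw [hl]
      have hp : 10 ^ (n + 2) = 100 * 10 ^ n := by ring
      rw [hp]
      linear_combination h1 + 10 * he - 10 * 10 ^ n * h2

/-- The multipliers `k = 9` and `k = 4`, with the leading digit `q` of their multiples. -/
def IsPair (k q : ℕ) : Prop := k = 9 ∧ q = 1 ∨ k = 4 ∧ q = 2

variable {k q : ℕ}

theorem carryLists_zero_zero (h : IsPair k q) (n : ℕ) :
    carryLists k 0 0 (n + 2) = wrap 0 0 '' carryLists k 0 0 n ∪
      wrap (10 - q) q '' carryLists k (k - 1) 0 n := by
  ext L
  constructor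
  · intro hL
    obtain ⟨a, b, M, rfl⟩ := exists_eq_wrap hL.1
    rw [wrap_mem_carryLists (by rcases h with h | h <;> omega)] at hL
    obtain ⟨ha, hb, c', d', hc, hd, h1, h2, hM⟩ := hL
    have : (a = 0 ∧ b = 0 ∧ c' = 0 ∧ d' = 0) ∨
        (a = 10 - q ∧ b = q ∧ c' = k - 1 ∧ d' = 0) := by
      rcases h with ⟨rfl, rfl⟩ | ⟨rfl, rfl⟩ <;> interval_cases b <;> omega
    rcases this with ⟨rfl, rfl, rfl, rfl⟩ | ⟨rfl, rfl, rfl, rfl⟩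
    exacts [Or.inl ⟨M, hM, rfl⟩, Or.inr ⟨M, hM, rfl⟩]
  · have hk : 0 < k := by rcases h with h | h <;> omega
    rintro (⟨M, hM, rfl⟩ | ⟨M, hM, rfl⟩) <;> rw [wrap_mem_carryLists hk]
    · exact ⟨by omega, by omega, 0, 0, hk, hk, by omega, by omega, hM⟩
    · refine ⟨?_, ?_, k - 1, 0, by omega, hk, ?_, ?_, hM⟩ <;>
        rcases h with ⟨rfl, rfl⟩ | ⟨rfl, rfl⟩ <;> omega

theorem carryLists_pred_zero (h : IsPair k q) (n : ℕ) :
    carryLists k (k - 1) 0 (n + 2) =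
      wrap (9 - q) (q - 1) '' carryLists k (k - 1) (k - 1) n := by
  have hk : k - 1 < k := by rcases h with h | h <;> omega
  ext L
  constructor
  · intro hL
    obtain ⟨a, b, M, rfl⟩ := exists_eq_wrap hL.1
    rw [wrap_mem_carryLists hk] at hL
    obtain ⟨ha, hb, c', d', hc, hd, h1, h2, hM⟩ := hL
    have : a = 9 - q ∧ b = q - 1 ∧ c' = k - 1 ∧ d' = k - 1 := by
      rcases h with ⟨rfl, rfl⟩ | ⟨rfl, rfl⟩ <;> interval_cases b <;> omega
    obtain ⟨rfl, rfl, rfl, rfl⟩ := this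
    exact ⟨M, hM, rfl⟩
  · rintro ⟨M, hM, rfl⟩
    rw [wrap_mem_carryLists hk]
    refine ⟨?_, ?_, k - 1, k - 1, hk, hk, ?_, ?_, hM⟩ <;>
      rcases h with ⟨rfl, rfl⟩ | ⟨rfl, rfl⟩ <;> omega

theorem carryLists_pred_pred (h : IsPair k q) (n : ℕ) :
    carryLists k (k - 1) (k - 1) (n + 2) = wrap 9 9 '' carryLists k (k - 1) (k - 1) n ∪
      wrap (q - 1) (9 - q) '' carryLists k 0 (k - 1) n := by
  have hk : k - 1 < k := by rcases h with h | h <;> omega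
  ext L
  constructor
  · intro hL
    obtain ⟨a, b, M, rfl⟩ := exists_eq_wrap hL.1
    rw [wrap_mem_carryLists hk] at hL
    obtain ⟨ha, hb, c', d', hc, hd, h1, h2, hM⟩ := hL
    have : (a = 9 ∧ b = 9 ∧ c' = k - 1 ∧ d' = k - 1) ∨
        (a = q - 1 ∧ b = 9 - q ∧ c' = 0 ∧ d' = k - 1) := by
      rcases h with ⟨rfl, rfl⟩ | ⟨rfl, rfl⟩ <;> interval_cases b <;> omega
    rcases this with ⟨rfl, rfl, rfl, rfl⟩ | ⟨rfl, rfl, rfl, rfl⟩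
    exacts [Or.inl ⟨M, hM, rfl⟩, Or.inr ⟨M, hM, rfl⟩]
  · rintro (⟨M, hM, rfl⟩ | ⟨M, hM, rfl⟩) <;> rw [wrap_mem_carryLists hk]
    · refine ⟨by omega, by omega, k - 1, k - 1, hk, hk, by omega, by omega, hM⟩
    · refine ⟨?_, ?_, 0, k - 1, by omega, hk, ?_, ?_, hM⟩ <;>
        rcases h with ⟨rfl, rfl⟩ | ⟨rfl, rfl⟩ <;> omega

theorem carryLists_zero_pred (h : IsPair k q) (n : ℕ) :
    carryLists k 0 (k - 1) (n + 2) = wrap q (10 - q) '' carryLists k 0 0 n := by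
  have hk : 0 < k := by rcases h with h | h <;> omega
  ext L
  constructor
  · intro hL
    obtain ⟨a, b, M, rfl⟩ := exists_eq_wrap hL.1
    rw [wrap_mem_carryLists hk] at hL
    obtain ⟨ha, hb, c', d', hc, hd, h1, h2, hM⟩ := hL
    have : a = q ∧ b = 10 - q ∧ c' = 0 ∧ d' = 0 := by
      rcases h with ⟨rfl, rfl⟩ | ⟨rfl, rfl⟩ <;> interval_cases b <;> omega
    obtain ⟨rfl, rfl, rfl, rfl⟩ := this
    exact ⟨M, hM, rfl⟩
  · rintro ⟨M, hM, rfl⟩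
    rw [wrap_mem_carryLists hk]
    refine ⟨?_, ?_, 0, 0, hk, hk, ?_, ?_, hM⟩ <;>
      rcases h with ⟨rfl, rfl⟩ | ⟨rfl, rfl⟩ <;> omega

theorem carryLists_length_zero (k c d : ℕ) :
    carryLists k c d 0 = if c = d then {[]} else ∅ := by
  ext L
  split_ifs with h <;> simp only [carryLists, List.length_eq_zero_iff, Set.mem_ofPred_eq,
    Set.mem_singleton_iff, Set.mem_empty_iff_false, iff_false]
  · constructor
    · exact fun hL => hL.1
    · rintro rfl
      simp [h]
  · rintro ⟨rfl, -, he⟩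
    simp at he
    exact h he

theorem mem_carryLists_length_one {k c d : ℕ} {L : List ℕ} :
    L ∈ carryLists k c d 1 ↔ ∃ a, L = [a] ∧ a < 10 ∧ k * a + c = a + d * 10 := by
  simp only [carryLists, Set.mem_ofPred_eq, List.length_eq_one_iff]
  constructor
  · rintro ⟨⟨a, rfl⟩, h1, h2⟩
    exact ⟨a, rfl, by simpa using h1, by simpa using h2⟩
  · rintro ⟨a, rfl, h1, h2⟩
    exact ⟨⟨a, rfl⟩, by simpa using h1, by simpa using h2⟩

theorem encard_carryLists_short (h : IsPair k q) {r : ℕ} (hr : r < 2) :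
    (carryLists k 0 0 r).encard = 1 ∧ (carryLists k (k - 1) 0 r).encard = 0 ∧
      (carryLists k (k - 1) (k - 1) r).encard = 1 ∧ (carryLists k 0 (k - 1) r).encard = 0 := by
  interval_cases r
  · simp only [carryLists_length_zero]
    rcases h with ⟨rfl, rfl⟩ | ⟨rfl, rfl⟩ <;> simp
  · refine ⟨Set.encard_eq_one.2 ⟨[0], ?_⟩, Set.encard_eq_zero.2 ?_,
      Set.encard_eq_one.2 ⟨[9], ?_⟩, Set.encard_eq_zero.2 ?_⟩ <;> ext L <;>
      simp only [mem_carryLists_length_one, Set.mem_singleton_iff, Set.mem_empty_iff_false,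
        iff_false]
    · constructor
      · rintro ⟨a, rfl, h1, h2⟩
        rcases h with ⟨rfl, rfl⟩ | ⟨rfl, rfl⟩ <;> simp <;> omega
      · rintro rfl
        exact ⟨0, by simp⟩
    · rintro ⟨a, rfl, h1, h2⟩
      rcases h with ⟨rfl, rfl⟩ | ⟨rfl, rfl⟩ <;> omega
    · constructor
      · rintro ⟨a, rfl, h1, h2⟩
        rcases h with ⟨rfl, rfl⟩ | ⟨rfl, rfl⟩ <;> simp <;> omega
      · rintro rfl
        refine ⟨9, rfl, by omega, ?_⟩
        rcases h with ⟨rfl, rfl⟩ | ⟨rfl, rfl⟩ <;> rfl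
    · rintro ⟨a, rfl, h1, h2⟩
      rcases h with ⟨rfl, rfl⟩ | ⟨rfl, rfl⟩ <;> omega

theorem disjoint_wrap_image {a b a' b' : ℕ} (h : a ≠ a') (S T : Set (List ℕ)) :
    Disjoint (wrap a b '' S) (wrap a' b' '' T) := by
  rw [Set.disjoint_left]
  rintro _ ⟨M, -, rfl⟩ ⟨M', -, e⟩
  simp only [wrap, List.cons.injEq] at e
  exact h e.1.symm

theorem encard_carryLists (h : IsPair k q) {r : ℕ} (hr : r < 2) (m : ℕ) :
    (carryLists k 0 0 (2 * m + r)).encard = Nat.fib (m + 1) ∧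
      (carryLists k (k - 1) 0 (2 * m + r)).encard = Nat.fib m ∧
      (carryLists k (k - 1) (k - 1) (2 * m + r)).encard = Nat.fib (m + 1) ∧
      (carryLists k 0 (k - 1) (2 * m + r)).encard = Nat.fib m := by
  induction m with
  | zero => simpa using encard_carryLists_short h hr
  | succ m ih =>
    obtain ⟨i1, i2, i3, i4⟩ := ih
    have hm : 2 * (m + 1) + r = 2 * m + r + 2 := by ring
    have hq : 0 ≠ 10 - q ∧ 9 ≠ q - 1 := by rcases h with h | h <;> omega
    have hf : ((Nat.fib (m + 1 + 1) : ℕ) : ℕ∞) = Nat.fib (m + 1) + Nat.fib m := by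
      rw [Nat.fib_add_two, add_comm]
      push_cast
      rfl
    rw [hm, carryLists_zero_zero h, carryLists_pred_zero h, carryLists_pred_pred h,
      carryLists_zero_pred h, Set.encard_union_eq (disjoint_wrap_image hq.1 _ _),
      Set.encard_union_eq (disjoint_wrap_image hq.2 _ _), hf]
    simp only [(wrap_injective _ _).encard_image, i1, i2, i3, i4, and_self]

/-- The reverse multiples with `t` digits. -/
def multiples (k t : ℕ) : Set ℕ :=
  {N | (Nat.digits 10 N).length = t ∧ IsReverseMultiple 10 k N}

theorem digits_eq_wrap_of_mem_multiples {n N : ℕ} (hk : 0 < k) (hN : N ∈ multiples k (n + 2)) :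
    ∃ a b M, Nat.digits 10 N = wrap a b M ∧ b ≠ 0 ∧ a < 10 ∧ b < 10 ∧ ∃ c' d', c' < k ∧ d' < k ∧
      k * a = b + 10 * c' ∧ a = k * b + d' ∧ M ∈ carryLists k c' d' n := by
  obtain ⟨hl, h0, he⟩ := hN
  obtain ⟨a, b, M, hw⟩ := exists_eq_wrap hl
  have hb : b ≠ 0 := by
    have := Nat.getLast_digit_ne_zero 10 h0.ne'
    simpa [hw, wrap] using this
  have hmem : wrap a b M ∈ carryLists k 0 0 (n + 2) := by
    rw [← hw]
    exact ⟨hl, fun x hx => Nat.digits_lt_base (by norm_num) hx, by simp [he, Nat.ofDigits_digits]⟩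
  rw [wrap_mem_carryLists hk] at hmem
  exact ⟨a, b, M, hw, hb, by simpa using hmem⟩

theorem eq_nine_or_four_of_mem_multiples {n N : ℕ} (h2 : 2 ≤ k) (h9 : k ≤ 9)
    (hN : N ∈ multiples k (n + 2)) : k = 9 ∨ k = 4 := by
  obtain ⟨a, b, M, -, hb, ha, hb', c', d', hc, hd, h1, h2, -⟩ :=
    digits_eq_wrap_of_mem_multiples (by omega) hN
  interval_cases k <;> interval_cases b <;> omega

theorem digits_image_multiples (h : IsPair k q) (n : ℕ) :
    Nat.digits 10 '' multiples k (n + 2) = wrap (10 - q) q '' carryLists k (k - 1) 0 n := by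
  have hk : 0 < k := by rcases h with h | h <;> omega
  ext L
  constructor
  · rintro ⟨N, hN, rfl⟩
    obtain ⟨a, b, M, hw, hb, ha, hb', c', d', hc, hd, h1, h2, hM⟩ :=
      digits_eq_wrap_of_mem_multiples hk hN
    have : a = 10 - q ∧ b = q ∧ c' = k - 1 ∧ d' = 0 := by
      rcases h with ⟨rfl, rfl⟩ | ⟨rfl, rfl⟩ <;> interval_cases b <;> omega
    obtain ⟨rfl, rfl, rfl, rfl⟩ := this
    exact ⟨M, hM, hw.symm⟩
  · intro hL
    have hmem : L ∈ carryLists k 0 0 (n + 2) := by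
      rw [carryLists_zero_zero h]
      exact Or.inr hL
    obtain ⟨M, -, rfl⟩ := hL
    obtain ⟨hl, hd, he⟩ := hmem
    have hq : q ≠ 0 := by rcases h with h | h <;> omega
    have hdig : Nat.digits 10 (Nat.ofDigits 10 (wrap (10 - q) q M)) = wrap (10 - q) q M :=
      Nat.digits_ofDigits 10 (by norm_num) _ hd (by simpa [wrap] using hq)
    refine ⟨_, ⟨by rw [hdig, hl], ?_, ?_⟩, hdig⟩
    · rw [ofDigits_wrap]
      positivity
    · rw [hdig]
      simpa using he.symm

theorem encard_multiples (h : IsPair k q) (n : ℕ) :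
    (multiples k (n + 2)).encard = Nat.fib (n / 2) := by
  rw [← (Nat.digits.injective 10).encard_image, digits_image_multiples h,
    (wrap_injective _ _).encard_image]
  have := (encard_carryLists h (Nat.mod_lt n two_pos) (n / 2)).2.1
  rwa [Nat.div_add_mod] at this

end ReverseMultiple

open ReverseMultiple in
theorem count_reverse_multiples_base10 (t : ℕ) (ht : 4 ≤ t) :
    {N : ℕ | (Nat.digits 10 N).length = t ∧
        ∃ k, 2 ≤ k ∧ k ≤ 9 ∧ IsReverseMultiple 10 k N}.ncard
      = 2 * Nat.fib (t / 2 - 1) := by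
  obtain ⟨n, rfl⟩ : ∃ n, t = n + 2 := ⟨t - 2, by omega⟩
  have hset : {N : ℕ | (Nat.digits 10 N).length = n + 2 ∧
      ∃ k, 2 ≤ k ∧ k ≤ 9 ∧ IsReverseMultiple 10 k N} =
        multiples 9 (n + 2) ∪ multiples 4 (n + 2) := by
    ext N
    constructor
    · rintro ⟨hl, k, h2, h9, hN⟩
      rcases eq_nine_or_four_of_mem_multiples h2 h9 ⟨hl, hN⟩ with rfl | rfl
      exacts [Or.inl ⟨hl, hN⟩, Or.inr ⟨hl, hN⟩]
    · rintro (⟨hl, hN⟩ | ⟨hl, hN⟩)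
      exacts [⟨hl, 9, by norm_num, by norm_num, hN⟩, ⟨hl, 4, by norm_num, by norm_num, hN⟩]
  have hdisj : Disjoint (multiples 9 (n + 2)) (multiples 4 (n + 2)) := by
    rw [Set.disjoint_left]
    rintro N ⟨-, h0, h9⟩ ⟨-, -, h4⟩
    omega
  rw [hset, Set.ncard_def, Set.encard_union_eq hdisj,
    encard_multiples (Or.inl ⟨rfl, rfl⟩), encard_multiples (Or.inr ⟨rfl, rfl⟩),
    show (n + 2) / 2 - 1 = n / 2 by omega, two_mul, ← Nat.cast_add, ENat.toNat_natCast]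
end
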